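/- For every initial value function V₀ : S → ℝ and all natural numbers n and k, the successive differences of the value-iteration sequence decay geometrically: ‖B^{n+k+1} V₀ − B^{n+k} V₀‖ ≤ (γ · α⁺)^k · ‖B^{n+1} V₀ − B^{n} V₀‖. -/

import Mathlib

theorem Finset.sup'_le_sup'_add {ι : Type*} {s : Finset ι} (hs : s.Nonempty) {f g : ι → ℝ} {c : ℝ}
    (h : ∀ i ∈ s, f i - g i ≤ c) : s.sup' hs f ≤ s.sup' hs g + c :=
  Finset.sup'_le hs f fun i hi => by linarith [h i hi, Finset.le_sup' g hi]

theorem Finset.abs_sup'_sub_sup'_le {ι : Type*} {s : Finset ι} (hs : s.Nonempty) {f g : ι → ℝ}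
    {c : ℝ} (h : ∀ i ∈ s, |f i - g i| ≤ c) : |s.sup' hs f - s.sup' hs g| ≤ c := by
  have hfg := Finset.sup'_le_sup'_add hs fun i hi => (abs_le.1 (h i hi)).2
  have hgf : s.sup' hs g ≤ s.sup' hs f + c :=
    Finset.sup'_le_sup'_add hs fun i hi => by linarith [(abs_le.1 (h i hi)).1]
  exact abs_le.2 ⟨by linarith, by linarith⟩

theorem abs_sum_mul_le_of_sum_eq_one {ι : Type*} [Fintype ι] {p v : ι → ℝ} {c : ℝ}
    (hp : ∀ i, 0 ≤ p i) (hsum : ∑ i, p i = 1) (hv : ∀ i, |v i| ≤ c) :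
    |∑ i, p i * v i| ≤ c :=
  calc |∑ i, p i * v i| ≤ ∑ i, |p i * v i| := Finset.abs_sum_le_sum_abs _ _
    _ ≤ ∑ i, p i * c := Finset.sum_le_sum fun i _ => by
      rw [abs_mul, abs_of_nonneg (hp i)]
      exact mul_le_mul_of_nonneg_left (hv i) (hp i)
    _ = c := by rw [← Finset.sum_mul, hsum, one_mul]

theorem stmt2
    {S A : Type} [Fintype S] [Nonempty S] [Fintype A] [Nonempty A]
    (α : S → A → ℝ) (T F : S → A → S → ℝ) (R : S → A → ℝ) (γ : ℝ)
    (W : A → S → ℝ)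
    (hα : ∀ s a, 0 ≤ α s a ∧ α s a ≤ 1)
    (hT : ∀ s a s', 0 ≤ T s a s') (hTsum : ∀ s a, ∑ s', T s a s' = 1)
    (hF : ∀ s a s', 0 ≤ F s a s') (hFsum : ∀ s a, ∑ s', F s a s' = 1)
    (hγ : 0 ≤ γ ∧ γ ≤ 1)
    (B : (S → ℝ) → (S → ℝ))
    (hB : ∀ V s, B V s =
      Finset.univ.sup' Finset.univ_nonempty (fun a : A =>
        R s a + γ * ∑ s', (α s a * T s a s' * V s' +
          (1 - α s a) * F s a s' * W a s')))
    (norm' : (S → ℝ) → ℝ)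
    (hnorm : ∀ V, norm' V = Finset.univ.sup' Finset.univ_nonempty (fun s : S => |V s|))
    (aplus : ℝ)
    (haplus : aplus = Finset.univ.sup' Finset.univ_nonempty (fun p : S × A => α p.1 p.2))
    : ∀ (V₀ : S → ℝ) (n k : ℕ),
      norm' (fun s => (B^[n + k + 1] V₀) s - (B^[n + k] V₀) s) ≤
        (γ * aplus) ^ k * norm' (fun s => (B^[n + 1] V₀) s - (B^[n] V₀) s) := by
  have abs_le_norm (V : S → ℝ) (s : S) : |V s| ≤ norm' V := by
    rw [hnorm]
    exact Finset.le_sup' (fun s => |V s|) (Finset.mem_univ s)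
  have le_aplus (s : S) (a : A) : α s a ≤ aplus := by
    rw [haplus]
    exact Finset.le_sup' (fun p : S × A => α p.1 p.2) (Finset.mem_univ (s, a))
  have aplus_nonneg : 0 ≤ aplus :=
    (hα (Classical.arbitrary S) (Classical.arbitrary A)).1.trans (le_aplus _ _)
  have contraction (U V : S → ℝ) :
      norm' (fun s => B U s - B V s) ≤ γ * aplus * norm' (fun s => U s - V s) := by
    rw [hnorm (fun s => B U s - B V s)]
    refine Finset.sup'_le _ _ fun s _ => ?_
    rw [hB, hB]
    refine Finset.abs_sup'_sub_sup'_le _ fun a _ => ?_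
    have hdiff :
        (R s a + γ * ∑ s', (α s a * T s a s' * U s' + (1 - α s a) * F s a s' * W a s')) -
          (R s a + γ * ∑ s', (α s a * T s a s' * V s' + (1 - α s a) * F s a s' * W a s')) =
        γ * α s a * ∑ s', T s a s' * (U s' - V s') := by
      rw [add_sub_add_left_eq_sub, ← mul_sub, ← Finset.sum_sub_distrib, mul_assoc,
        Finset.mul_sum _ _ (α s a)]
      congr 1
      exact Finset.sum_congr rfl fun s' _ => by ring
    rw [hdiff, abs_mul, abs_of_nonneg (mul_nonneg hγ.1 (hα s a).1)]
    exact mul_le_mul (mul_le_mul_of_nonneg_left (le_aplus s a) hγ.1)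
      (abs_sum_mul_le_of_sum_eq_one (hT s a) (hTsum s a) (abs_le_norm fun s => U s - V s))
      (abs_nonneg _) (mul_nonneg hγ.1 aplus_nonneg)
  intro V₀ n k
  induction k with
  | zero => simp
  | succ k ih =>
    have step := contraction (B^[n + k + 1] V₀) (B^[n + k] V₀)
    simp only [← Function.iterate_succ_apply' B] at step
    refine step.trans ?_
    rw [pow_succ', mul_assoc (γ * aplus) (_ ^ k)]
    exact mul_le_mul_of_nonneg_left ih (mul_nonneg hγ.1 aplus_nonneg)
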